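/- Let n ∈ ℕ be odd and define F_k^n = 2^{−n} · C(n, ⌊n/2⌋) · C(⌊n/2⌋, ⌊k/2⌋)² / C(n,k) for 0 ≤ k ≤ n and F_k^n = 0 for k > n. Define real coefficients q_0, …, q_n by: q_n = √( 2^{−n} · C(n, ⌊n/2⌋) / n! ); for even k with 0 < k < n, q_{n−k} = (−1)^{k/2} · 2^{k/2} · (k/2)! · ((n+1)/(n−k+1)) · C(⌊n/2⌋, k/2)² · q_n; and q_{n−k} = 0 for all other k with 0 < k ≤ n. Then for all x ∈ ℝ, ∑_{k=0}^{n} (−1)^k F_k^n L_k(x) = ∑_{l=0}^{n} x^l · ∑_{i+j=2l, 0≤i,j≤n} q_i q_j. -/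

import Mathlib

/-- The `k`-th Laguerre polynomial: `L_k(x) = ∑_{l=0}^k ((-1)^l / l!) C(k,l) x^l`. -/
noncomputable def laguerreL (k : ℕ) (x : ℝ) : ℝ :=
  ∑ l ∈ Finset.range (k + 1), ((-1 : ℝ) ^ l / (l.factorial : ℝ)) * (k.choose l : ℝ) * x ^ l

open Polynomial in
/-- The Euler operator `X d/dX`. -/
noncomputable def eulerOp (p : ℝ[X]) : ℝ[X] := X * derivative p

open Polynomial in
theorem coeff_eulerOp (p : ℝ[X]) (i : ℕ) : (eulerOp p).coeff i = i * p.coeff i := by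
  cases i with
  | zero => simp [eulerOp]
  | succ i => rw [eulerOp, coeff_X_mul, coeff_derivative]; push_cast; ring

open Polynomial in
/-- The symmetric square of the equation `θ² p = p + X² (θ p - c p)`, with `θ = X d/dX`. -/
theorem eulerOp_sq_of_eulerOp (p : ℝ[X]) (c : ℝ)
    (h : eulerOp (eulerOp p) = p + X ^ 2 * (eulerOp p - C c * p)) :
    eulerOp (eulerOp (eulerOp (p * p))) = 4 * eulerOp (p * p)
      + X ^ 2 * (3 * eulerOp (eulerOp (p * p)) + C (2 - 4 * c) * eulerOp (p * p)
          - C (4 + 4 * c) * (p * p))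
      - X ^ 2 * (X ^ 2 * (2 * eulerOp (p * p) - C (4 * c) * (p * p))) := by
  have h' := congrArg derivative h
  simp only [eulerOp, derivative_mul, derivative_add, derivative_sub, derivative_X,
    derivative_C, derivative_X_pow, C_add, C_sub, C_mul, map_ofNat] at h h' ⊢
  simp only [Nat.cast_ofNat, map_ofNat, Nat.add_one_sub_one, pow_one] at h h' ⊢
  linear_combination (2 * p * X) * h' + (6 * (X * derivative p) - 4 * X ^ 2 * p) * h

/-- The three-term recurrence satisfied by the coefficients of the polynomial in question. -/
def SquareRecurrence (n : ℕ) (S : ℕ → ℝ) : Prop :=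
  ∀ l : ℕ, 8 * ((l : ℝ) + 1) * (l + 2) * (l + 3) * S (l + 2)
    = (12 * ((l : ℝ) + 1) ^ 2 + (4 - 8 * n) * (l + 1) - 4 - 4 * n) * S (l + 1)
      - 4 * ((l : ℝ) - n) * S l

theorem SquareRecurrence.ext {n : ℕ} {S T : ℕ → ℝ} (hS : SquareRecurrence n S)
    (hT : SquareRecurrence n T) (h : ∀ l, n ≤ l → S l = T l) (l : ℕ) : S l = T l := by
  have key : ∀ t l : ℕ, n ≤ l + t → S l = T l := by
    intro t
    induction t with
    | zero => exact h
    | succ t ih =>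
      intro l hl
      by_cases hln : n ≤ l
      · exact h l hln
      have h1 := ih (l + 1) (by omega)
      have h2 := ih (l + 2) (by omega)
      have h3 := hS l
      have h4 := hT l
      rw [h1, h2] at h3
      have h5 : ((l : ℝ) - n) ≠ 0 := by
        rw [sub_ne_zero]; exact_mod_cast (by omega : l ≠ n)
      apply mul_left_cancel₀ h5
      linear_combination (h3 - h4) / 4
  exact key n l (by omega)

open Polynomial in
theorem squareRecurrence_coeff_mul_self (n : ℕ) (p : ℝ[X]) (h0 : p.coeff 0 = 0)
    (hp : ∀ i : ℕ, ((i : ℝ) + 1) * (i + 3) * p.coeff (i + 2) = ((i : ℝ) - n) * p.coeff i) :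
    SquareRecurrence n (fun l => (p * p).coeff (2 * l)) := by
  have h : eulerOp (eulerOp p) = p + X ^ 2 * (eulerOp p - C (n : ℝ) * p) := by
    ext i
    rcases i with _ | _ | i
    · simp [coeff_eulerOp, h0]
    · rw [coeff_add, coeff_eulerOp, coeff_eulerOp, coeff_X_pow_mul']
      simp
    · rw [coeff_add, coeff_eulerOp, coeff_eulerOp, coeff_X_pow_mul, coeff_sub, coeff_C_mul,
        coeff_eulerOp]
      push_cast
      linear_combination hp i
  have hsq := eulerOp_sq_of_eulerOp p n h
  intro l
  have hc := congrArg (fun r : ℝ[X] => r.coeff (2 * l + 2 + 2)) hsq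
  have e4 : (4 : ℝ[X]) = C 4 := rfl
  have e3 : (3 : ℝ[X]) = C 3 := rfl
  have e2 : (2 : ℝ[X]) = C 2 := rfl
  simp only [e4, e3, e2, coeff_add, coeff_sub, coeff_X_pow_mul, coeff_C_mul, coeff_eulerOp] at hc
  push_cast at hc
  have a1 : 2 * (l + 1) = 2 * l + 2 := by ring
  have a2 : 2 * (l + 2) = 2 * l + 2 + 2 := by ring
  simp only [a1, a2]
  linear_combination hc

/-- The coefficient of `(-x)^l` in the `k`-th Laguerre polynomial. -/
noncomputable def laguerreCoeff (l k : ℕ) : ℝ := (k.choose l : ℝ) / l.factorial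

theorem laguerreCoeff_succ (l k : ℕ) :
    laguerreCoeff (l + 1) k = laguerreCoeff l k * ((k : ℝ) - l) / ((l : ℝ) + 1) ^ 2 := by
  have h : (k.choose (l + 1) : ℝ) * (l + 1) = k.choose l * ((k : ℝ) - l) := by
    rcases le_or_gt l k with hk | hk
    · rw [← Nat.cast_sub hk]; exact_mod_cast Nat.choose_succ_right_eq k l
    · rw [Nat.choose_eq_zero_of_lt hk, Nat.choose_eq_zero_of_lt (by omega)]; simp
  have hl : (l.factorial : ℝ) ≠ 0 := by positivity
  have hl' : (l : ℝ) + 1 ≠ 0 := by positivity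
  unfold laguerreCoeff
  rw [Nat.factorial_succ]
  push_cast
  field_simp
  linear_combination h

theorem laguerreCoeff_succ_succ (l k : ℕ) :
    laguerreCoeff (l + 1) (k + 1) = ((k : ℝ) + 1) * laguerreCoeff l k / ((l : ℝ) + 1) ^ 2 := by
  have h : ((k : ℝ) + 1) * k.choose l = (k + 1).choose (l + 1) * (l + 1) := by
    exact_mod_cast Nat.add_one_mul_choose_eq k l
  have hl : (l.factorial : ℝ) ≠ 0 := by positivity
  have hl' : (l : ℝ) + 1 ≠ 0 := by positivity
  unfold laguerreCoeff
  rw [Nat.factorial_succ]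
  push_cast
  field_simp
  linear_combination -h

theorem exists_laguerreCoeff_eq (l k : ℕ) : ∃ v : ℝ,
    laguerreCoeff l k = ((k : ℝ) - l + 1) * v ∧ laguerreCoeff l (k + 1) = ((k : ℝ) + 1) * v := by
  cases l with
  | zero =>
    have hk : (k : ℝ) + 1 ≠ 0 := by positivity
    exact ⟨1 / (k + 1), by simp [laguerreCoeff, hk], by simp [laguerreCoeff, hk]⟩
  | succ l =>
    refine ⟨laguerreCoeff l k / ((l : ℝ) + 1) ^ 2, ?_, ?_⟩
    · rw [laguerreCoeff_succ]; push_cast; ring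
    · rw [laguerreCoeff_succ_succ]; ring

/-- The part of the weights common to the indices `2 * j` and `2 * j + 1`. -/
noncomputable def pairWeight (m j : ℕ) : ℝ :=
  (m.choose j : ℝ) ^ 2 * (2 * j).factorial * (2 * m - 2 * j).factorial

theorem pairWeight_succ (m j : ℕ) (hj : j ≤ m) :
    pairWeight m (j + 1) * (j + 1) * (2 * (m : ℝ) - 2 * j - 1)
      = pairWeight m j * ((m : ℝ) - j) * (2 * j + 1) := by
  rcases hj.eq_or_lt with rfl | hj
  · simp [pairWeight]
  obtain ⟨t, rfl⟩ := Nat.exists_eq_add_of_lt hj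
  have hc : ((j + t + 1).choose (j + 1) : ℝ) * (j + 1) = (j + t + 1).choose j * (t + 1) := by
    have := Nat.choose_succ_right_eq (j + t + 1) j
    rw [show j + t + 1 - j = t + 1 by omega] at this
    exact_mod_cast this
  unfold pairWeight
  rw [show 2 * (j + t + 1) - 2 * (j + 1) = 2 * t by omega,
    show 2 * (j + t + 1) - 2 * j = 2 * t + 1 + 1 by omega,
    show 2 * (j + 1) = 2 * j + 1 + 1 by omega]
  simp only [Nat.factorial_succ]
  push_cast
  linear_combination (2 * (2 * (j : ℝ) + 1) * (2 * j).factorial * (2 * t).factorial * (2 * t + 1)) *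
    (((j + t + 1).choose (j + 1) : ℝ) * (j + 1) + (j + t + 1).choose j * (t + 1)) * hc

/-- The contribution of the indices `2 * j` and `2 * j + 1`. -/
noncomputable def pairTerm (m l j : ℕ) : ℝ :=
  pairWeight m j * ((2 * (m : ℝ) + 1 - 2 * j) * laguerreCoeff l (2 * j)
    - (2 * (j : ℝ) + 1) * laguerreCoeff l (2 * j + 1))

/-- The telescoping certificate for the recurrence of `∑ j, pairTerm m l j`. -/
noncomputable def pairCertificate (m l j : ℕ) : ℝ :=
  pairWeight m j * (2 * (m : ℝ) + 1 - 2 * j) * laguerreCoeff (l + 1) (2 * j) *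
    (16 * ((l : ℝ) + 1) * j ^ 2 - (8 * ((l : ℝ) + 2) * m + 4 * ((l : ℝ) ^ 2 + 3 * l + 4)) * j
      + 4 * ((l : ℝ) + 1) * (l + 2) * (m + 1)) / ((l : ℝ) + 2)

theorem pairCertificate_telescope (m l j : ℕ) (hj : j ≤ m) :
    4 * ((l : ℝ) + 1) * (l + 2) * (l + 3) * pairTerm m (l + 2) j
      - 2 * (-3 * (l : ℝ) * (l - 1) + (4 * m - 8) * l + 6 * m) * pairTerm m (l + 1) j
      + (2 * (l : ℝ) - 2 - 4 * m) * pairTerm m l j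
      = pairCertificate m l (j + 1) - pairCertificate m l j := by
  obtain ⟨v, h0, h1⟩ := exists_laguerreCoeff_eq l (2 * j)
  have hw := pairWeight_succ m j hj
  have hl1 : (l : ℝ) + 1 ≠ 0 := by positivity
  have hl2 : (l : ℝ) + 2 ≠ 0 := by positivity
  have hl2' : (l : ℝ) + 1 + 1 ≠ 0 := by positivity
  have hG : pairCertificate m l (j + 1)
      = pairWeight m j * ((m : ℝ) - j) * (2 * j + 1) * (2 * (2 * (j : ℝ) + 1) * v
          / ((l : ℝ) + 1) ^ 2) *
        (16 * ((l : ℝ) + 1) * (j + 1) ^ 2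
          - (8 * ((l : ℝ) + 2) * m + 4 * ((l : ℝ) ^ 2 + 3 * l + 4)) * (j + 1)
          + 4 * ((l : ℝ) + 1) * (l + 2) * (m + 1)) / ((l : ℝ) + 2) := by
    rw [← hw, pairCertificate, show 2 * (j + 1) = 2 * j + 1 + 1 by ring,
      laguerreCoeff_succ_succ, h1]
    push_cast
    ring
  rw [hG]
  simp only [pairCertificate, pairTerm, show l + 2 = l + 1 + 1 from rfl, laguerreCoeff_succ,
    h0, h1]
  push_cast
  field_simp
  ring

theorem sum_pairTerm_recurrence (m l : ℕ) :
    4 * ((l : ℝ) + 1) * (l + 2) * (l + 3) * ∑ j ∈ Finset.range (m + 1), pairTerm m (l + 2) j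
      - 2 * (-3 * (l : ℝ) * (l - 1) + (4 * m - 8) * l + 6 * m) *
        ∑ j ∈ Finset.range (m + 1), pairTerm m (l + 1) j
      + (2 * (l : ℝ) - 2 - 4 * m) * ∑ j ∈ Finset.range (m + 1), pairTerm m l j = 0 := by
  rw [Finset.mul_sum, Finset.mul_sum, Finset.mul_sum, ← Finset.sum_sub_distrib,
    ← Finset.sum_add_distrib, Finset.sum_congr rfl fun j hj =>
      pairCertificate_telescope m l j (Finset.mem_range_succ_iff.mp hj), Finset.sum_range_sub]
  simp [pairCertificate, pairWeight, laguerreCoeff]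

theorem squareRecurrence_sum_pairTerm (m : ℕ) (c : ℝ) :
    SquareRecurrence (2 * m + 1)
      (fun l => c * ((-1) ^ l * ∑ j ∈ Finset.range (m + 1), pairTerm m l j)) := by
  intro l
  simp only [pow_succ]
  push_cast
  linear_combination (2 * c * (-1) ^ l) * sum_pairTerm_recurrence m l

theorem sum_range_two_mul (f : ℕ → ℝ) (m : ℕ) :
    ∑ k ∈ Finset.range (2 * m), f k = ∑ j ∈ Finset.range m, (f (2 * j) + f (2 * j + 1)) := by
  induction m with
  | zero => simp
  | succ m ih =>
    rw [show 2 * (m + 1) = 2 * m + 1 + 1 by ring, Finset.sum_range_succ, Finset.sum_range_succ,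
      Finset.sum_range_succ, ih]
    ring

/-- The weight `F_k^n` with the inverse binomial coefficient written out in factorials. -/
theorem weight_eq_factorial (m k : ℕ) (hk : k ≤ 2 * m + 1) (a b : ℝ) :
    a * b / (2 ^ (2 * m + 1) * ((2 * m + 1).choose k : ℝ))
      = a / (2 ^ (2 * m + 1) * (2 * m + 1).factorial) *
        (b * k.factorial * (2 * m + 1 - k).factorial) := by
  have hc : ((2 * m + 1).choose k : ℝ) ≠ 0 := by
    exact_mod_cast (Nat.choose_pos hk).ne'
  have h : ((2 * m + 1).choose k : ℝ) * k.factorial * (2 * m + 1 - k).factorial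
      = (2 * m + 1).factorial := by exact_mod_cast Nat.choose_mul_factorial_mul_factorial hk
  rw [← h]
  have h1 : (k.factorial : ℝ) ≠ 0 := by positivity
  have h2 : ((2 * m + 1 - k).factorial : ℝ) ≠ 0 := by positivity
  field_simp

theorem sum_weight_eq_sum_pairTerm (m l : ℕ) (F : ℕ → ℝ) (c : ℝ)
    (hF : ∀ k ≤ 2 * m + 1, F k =
      c * ((m.choose (k / 2) : ℝ) ^ 2 * k.factorial * (2 * m + 1 - k).factorial)) :
    ∑ k ∈ Finset.range (2 * m + 1 + 1), (-1 : ℝ) ^ k * F k * laguerreCoeff l k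
      = c * ∑ j ∈ Finset.range (m + 1), pairTerm m l j := by
  rw [show 2 * m + 1 + 1 = 2 * (m + 1) by ring, sum_range_two_mul, Finset.mul_sum]
  refine Finset.sum_congr rfl fun j hj => ?_
  obtain ⟨t, rfl⟩ := Nat.exists_eq_add_of_le (Finset.mem_range_succ_iff.mp hj)
  rw [hF _ (by omega), hF _ (by omega), pairTerm, pairWeight,
    show (2 * j + 1) / 2 = j by omega, show 2 * j / 2 = j by omega,
    show 2 * (j + t) + 1 - 2 * j = 2 * t + 1 by omega,
    show 2 * (j + t) + 1 - (2 * j + 1) = 2 * t by omega,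
    show 2 * (j + t) - 2 * j = 2 * t by omega]
  simp only [Nat.factorial_succ, pow_succ, pow_mul]
  push_cast
  ring

theorem sum_mul_laguerreL (n : ℕ) (w : ℕ → ℝ) (x : ℝ) :
    ∑ k ∈ Finset.range (n + 1), w k * laguerreL k x
      = ∑ l ∈ Finset.range (n + 1), x ^ l *
          ((-1) ^ l * ∑ k ∈ Finset.range (n + 1), w k * laguerreCoeff l k) := by
  have h : ∀ k ∈ Finset.range (n + 1), w k * laguerreL k x
      = ∑ l ∈ Finset.range (n + 1), x ^ l * ((-1) ^ l * (w k * laguerreCoeff l k)) := by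
    intro k hk
    rw [laguerreL, Finset.mul_sum]
    refine Finset.sum_subset_zero_on_sdiff ?_ ?_ ?_
    · exact Finset.range_subset_range.mpr (Finset.mem_range.mp hk)
    · intro l hl
      simp only [Finset.mem_sdiff, Finset.mem_range] at hl
      simp [laguerreCoeff, Nat.choose_eq_zero_of_lt (by omega : k < l)]
    · intro l _
      rw [laguerreCoeff]
      ring
  rw [Finset.sum_congr rfl h, Finset.sum_comm]
  simp only [Finset.mul_sum]

theorem coeff_recurrence (m : ℕ) (q : ℕ → ℝ)
    (hqe : ∀ k : ℕ, 0 < k → k < 2 * m + 1 → k % 2 = 0 →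
      q (2 * m + 1 - k) = (-1 : ℝ) ^ (k / 2) * (2 : ℝ) ^ (k / 2) * ((k / 2).factorial : ℝ) *
        ((((2 * m + 1 : ℕ) : ℝ) + 1) / (((2 * m + 1 : ℕ) : ℝ) - (k : ℝ) + 1)) *
        (m.choose (k / 2) : ℝ) ^ 2 * q (2 * m + 1))
    (r : ℕ) (hr : r < m) :
    (2 * ((m : ℝ) - r)) * (2 * ((m : ℝ) - r + 1)) * q (2 * m + 1 - 2 * r)
      = -(2 * ((r : ℝ) + 1)) * q (2 * m + 1 - 2 * (r + 1)) := by
  have hq : ∀ s ≤ m, q (2 * m + 1 - 2 * s) = (-2 : ℝ) ^ s * s.factorial *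
      (((m : ℝ) + 1) / ((m : ℝ) - s + 1)) * (m.choose s : ℝ) ^ 2 * q (2 * m + 1) := by
    intro s hs
    have hs' : (s : ℝ) ≤ m := by exact_mod_cast hs
    have hm : (m : ℝ) + 1 ≠ 0 := by positivity
    rcases Nat.eq_zero_or_pos s with rfl | hs0
    · simp [hm]
    have h1 : (m : ℝ) - s + 1 ≠ 0 := by linarith
    have h2 : 2 * (m : ℝ) + 1 - 2 * s + 1 ≠ 0 := by linarith
    rw [hqe (2 * s) (by omega) (by omega) (by omega), show 2 * s / 2 = s by omega, ← mul_pow]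
    push_cast
    rw [show (-1 : ℝ) * 2 = -2 by norm_num, show (2 * (m : ℝ) + 1 + 1) / (2 * m + 1 - 2 * s + 1)
      = (m + 1) / ((m : ℝ) - s + 1) by field_simp; ring]
  obtain ⟨t, rfl⟩ := Nat.exists_eq_add_of_lt hr
  have hc : ((r + t + 1).choose (r + 1) : ℝ) * (r + 1) = (r + t + 1).choose r * (t + 1) := by
    have := Nat.choose_succ_right_eq (r + t + 1) r
    rw [show r + t + 1 - r = t + 1 by omega] at this
    exact_mod_cast this
  rw [hq r hr.le, hq (r + 1) hr, Nat.factorial_succ, pow_succ]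
  push_cast
  have e1 : (r : ℝ) + t + 1 - r = t + 1 := by ring
  have e2 : (r : ℝ) + t + 1 - (r + 1) + 1 = t + 1 := by ring
  rw [e1, e2]
  have h1 : (t : ℝ) + 1 ≠ 0 := by positivity
  have h2 : (t : ℝ) + 1 + 1 ≠ 0 := by positivity
  field_simp
  linear_combination (-2 : ℝ) * (-2) ^ r * q (2 * (r + t + 1) + 1) * (((r + t + 1).choose (r + 1) : ℝ) * (r + 1)
    + (r + t + 1).choose r * (t + 1)) * hc

open Polynomial in
theorem coeff_sum_mul_self (n : ℕ) (q : ℕ → ℝ) (d : ℕ) :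
    ((∑ i ∈ Finset.range (n + 1), C (q i) * X ^ i) *
      (∑ i ∈ Finset.range (n + 1), C (q i) * X ^ i)).coeff d
      = ∑ i ∈ Finset.range (n + 1), ∑ j ∈ Finset.range (n + 1),
          if i + j = d then q i * q j else 0 := by
  rw [Finset.sum_mul_sum, finsetSum_coeff]
  refine Finset.sum_congr rfl fun i _ => ?_
  rw [finsetSum_coeff]
  refine Finset.sum_congr rfl fun j _ => ?_
  rw [show C (q i) * X ^ i * (C (q j) * X ^ j) = C (q i * q j) * X ^ (i + j) by
    rw [C_mul, pow_add]; ring, coeff_C_mul_X_pow]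
  simp only [eq_comm]

theorem sum_ite_top (n : ℕ) (q : ℕ → ℝ) :
    (∑ i ∈ Finset.range (n + 1), ∑ j ∈ Finset.range (n + 1),
      if i + j = 2 * n then q i * q j else 0) = q n * q n := by
  rw [Finset.sum_eq_single n, Finset.sum_eq_single n]
  · rw [if_pos (by ring)]
  · intro j _ hj
    rw [if_neg (by omega)]
  · simp
  · intro i hi hin
    refine Finset.sum_eq_zero fun j hj => ?_
    rw [Finset.mem_range] at hi hj
    rw [if_neg (by omega)]
  · simp

theorem sum_ite_above (n l : ℕ) (hl : n < l) (q : ℕ → ℝ) :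
    (∑ i ∈ Finset.range (n + 1), ∑ j ∈ Finset.range (n + 1),
      if i + j = 2 * l then q i * q j else 0) = 0 := by
  refine Finset.sum_eq_zero fun i hi => Finset.sum_eq_zero fun j hj => ?_
  rw [Finset.mem_range] at hi hj
  rw [if_neg (by omega)]

/-- odd case: the sum-of-squares identity
`∑_{k=0}^{n} (−1)^k F_k^n L_k(x) = ∑_{l=0}^{n} x^l ∑_{i+j=2l, 0≤i,j≤n} q_i q_j`.
Here `⌊·⌋` is realised by natural-number division. -/
theorem sos_identity_odd (n : ℕ) (hn : Odd n) (F : ℕ → ℝ) (q : ℕ → ℝ)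
    (hF : ∀ k ≤ n, F k =
      ((n.choose (n / 2) : ℝ) * ((n / 2).choose (k / 2) : ℝ) ^ 2) /
        (2 ^ n * (n.choose k : ℝ)))
    (hF' : ∀ k : ℕ, n < k → F k = 0)
    (hqn : q n = Real.sqrt ((n.choose (n / 2) : ℝ) / (2 ^ n * (n.factorial : ℝ))))
    (hqe : ∀ k : ℕ, 0 < k → k < n → k % 2 = 0 →
      q (n - k) = (-1 : ℝ) ^ (k / 2) * (2 : ℝ) ^ (k / 2) * ((k / 2).factorial : ℝ) *
        (((n : ℝ) + 1) / ((n : ℝ) - (k : ℝ) + 1)) * ((n / 2).choose (k / 2) : ℝ) ^ 2 * q n)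
    (hqo : ∀ k : ℕ, 0 < k → k ≤ n → ¬(k % 2 = 0 ∧ k < n) → q (n - k) = 0) :
    ∀ x : ℝ,
      (∑ k ∈ Finset.range (n + 1), (-1 : ℝ) ^ k * F k * laguerreL k x)
        = ∑ l ∈ Finset.range (n + 1), x ^ l *
            ∑ i ∈ Finset.range (n + 1), ∑ j ∈ Finset.range (n + 1),
              if i + j = 2 * l then q i * q j else 0 := by
  intro x
  obtain ⟨m, rfl⟩ := hn
  have hm : (2 * m + 1) / 2 = m := by omega
  rw [hm] at hF hqn hqe
  set c : ℝ := ((2 * m + 1).choose m : ℝ) / (2 ^ (2 * m + 1) * ((2 * m + 1).factorial : ℝ))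
    with hc
  have hsum := fun l => sum_weight_eq_sum_pairTerm m l F c fun k hk => by
    rw [hF k hk, weight_eq_factorial m k hk]
  rw [sum_mul_laguerreL (2 * m + 1) (fun k => (-1) ^ k * F k)]
  refine Finset.sum_congr rfl fun l _ => congrArg (x ^ l * ·) ?_
  have hS : SquareRecurrence (2 * m + 1) (fun l => (-1) ^ l *
      ∑ k ∈ Finset.range (2 * m + 1 + 1), (-1 : ℝ) ^ k * F k * laguerreCoeff l k) := by
    simp only [hsum, mul_left_comm _ c]
    exact squareRecurrence_sum_pairTerm m c
  let p : Polynomial ℝ := ∑ i ∈ Finset.range (2 * m + 1 + 1), Polynomial.C (q i) * Polynomial.X ^ i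
  have hp : ∀ i, p.coeff i = if i ≤ 2 * m + 1 then q i else 0 := by
    intro i
    simp [p, Polynomial.finsetSum_coeff, Polynomial.coeff_X_pow]
  have hq_even : ∀ i ≤ m, q (2 * i) = 0 := by
    intro i hi
    have := hqo (2 * m + 1 - 2 * i) (by omega) (by omega) (by omega)
    rwa [show 2 * m + 1 - (2 * m + 1 - 2 * i) = 2 * i by omega] at this
  have hT : SquareRecurrence (2 * m + 1) (fun l => ∑ i ∈ Finset.range (2 * m + 1 + 1),
      ∑ j ∈ Finset.range (2 * m + 1 + 1), if i + j = 2 * l then q i * q j else 0) := by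
    simp only [← coeff_sum_mul_self]
    refine squareRecurrence_coeff_mul_self (2 * m + 1) p ?_ fun i => ?_
    · rw [hp, if_pos (by omega)]
      exact hq_even 0 (by omega)
    rw [hp, hp]
    obtain ⟨j, rfl | rfl⟩ := Nat.even_or_odd' i
    · have h1 : (if 2 * j + 2 ≤ 2 * m + 1 then q (2 * j + 2) else 0) = 0 :=
        ite_eq_right_iff.mpr fun h => hq_even (j + 1) (by omega)
      have h2 : (if 2 * j ≤ 2 * m + 1 then q (2 * j) else 0) = 0 :=
        ite_eq_right_iff.mpr fun h => hq_even j (by omega)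
      rw [h1, h2, mul_zero, mul_zero]
    · rcases lt_trichotomy j m with h | rfl | h
      · rw [if_pos (by omega), if_pos (by omega)]
        obtain ⟨r, rfl⟩ := Nat.exists_eq_add_of_lt h
        have hr := coeff_recurrence (j + r + 1) q hqe r (by omega)
        rw [show 2 * (j + r + 1) + 1 - 2 * r = 2 * j + 1 + 2 by omega,
          show 2 * (j + r + 1) + 1 - 2 * (r + 1) = 2 * j + 1 by omega] at hr
        push_cast at hr ⊢
        linear_combination hr
      · rw [if_neg (by omega)]
        push_cast
        ring
      · rw [if_neg (by omega), if_neg (by omega), mul_zero, mul_zero]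
  refine hS.ext hT (fun l hl => ?_) l
  rcases hl.eq_or_lt with rfl | hl
  · have hc0 : 0 ≤ c := by positivity
    rw [sum_ite_top, hqn, Real.mul_self_sqrt hc0, Finset.sum_range_succ, Finset.sum_eq_zero,
      hF _ le_rfl, laguerreCoeff, hm, Nat.choose_self, Nat.choose_self, hc]
    · have h1 : ((-1 : ℝ) ^ (2 * m + 1)) * (-1) ^ (2 * m + 1) = 1 := by
        rw [← mul_pow]; norm_num
      push_cast
      field_simp
      linear_combination ((2 * m + 1).choose m : ℝ) * h1
    · intro k hk
      rw [laguerreCoeff, Nat.choose_eq_zero_of_lt (Finset.mem_range.mp hk)]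
      simp
  · rw [sum_ite_above _ _ hl, Finset.sum_eq_zero, mul_zero]
    intro k hk
    rw [Finset.mem_range] at hk
    rw [laguerreCoeff, Nat.choose_eq_zero_of_lt (by omega)]
    simp
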